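/- arXiv:2604.26540 — 2 statements merged into one kernel-verified Lean document; each statement's English description precedes it below -/
import Mathlib

section
/- Let X and Y be locally compact Hausdorff spaces and let T : C₀(X)⁺ → C₀(Y)⁺ be a bijection satisfying ‖T(f+g)‖ = ‖Tf + Tg‖ for all f, g ∈ C₀(X)⁺. Let y ∈ Y and let x₀ ∈ X be the unique point with ⋂_{f ∈ F_y} supp(f) = {x₀}, where F_y = {f ∈ C₀(X)⁺ : Tf(y) > 0}. Then for every f ∈ C₀(X)⁺ and every e ∈ C₀(X)⁺ equal to 1 on some open neighborhood of x₀, one has Tf(y) = Te(y)·f(x₀). -/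
open scoped ZeroAtInfty

/-- The positive cone of `C₀(X, ℝ)`. -/
def posCone (X : Type*) [TopologicalSpace X] : Set C₀(X, ℝ) :=
  {f | ∀ x, 0 ≤ f x}

namespace posCone

variable {X Y : Type*} [TopologicalSpace X] [TopologicalSpace Y]

theorem add_mem {f g : C₀(X, ℝ)} (hf : f ∈ posCone X) (hg : g ∈ posCone X) :
    f + g ∈ posCone X :=
  fun x => add_nonneg (hf x) (hg x)

theorem nsmul_mem {f : C₀(X, ℝ)} (hf : f ∈ posCone X) (n : ℕ) : n • f ∈ posCone X :=
  fun x => nsmul_nonneg (hf x) n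

theorem apply_le_norm (u : C₀(X, ℝ)) (x : X) : u x ≤ ‖u‖ := by
  rw [← ZeroAtInftyContinuousMap.norm_toBCF_eq_norm]
  exact (le_abs_self _).trans (u.toBCF.norm_coe_le_norm x)

theorem norm_le {u : C₀(X, ℝ)} (hu : u ∈ posCone X) {C : ℝ} (x₀ : X) (h : ∀ x, u x ≤ C) :
    ‖u‖ ≤ C := by
  rw [← ZeroAtInftyContinuousMap.norm_toBCF_eq_norm]
  refine (BoundedContinuousFunction.norm_le ((hu x₀).trans (h x₀))).2 fun x => ?_
  exact (abs_of_nonneg (hu x)).trans_le (h x)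

/-- The positive part of a function in `C₀(X, ℝ)`. -/
def positivePart (u : C₀(X, ℝ)) : C₀(X, ℝ) where
  toFun x := max (u x) 0
  continuous_toFun := by fun_prop
  zero_at_infty' := by
    simpa using (zero_at_infty u).max (tendsto_const_nhds (x := (0 : ℝ)))

theorem positivePart_apply (u : C₀(X, ℝ)) (x : X) : positivePart u x = max (u x) 0 := rfl

theorem positivePart_mem (u : C₀(X, ℝ)) : positivePart u ∈ posCone X :=
  fun _ => le_max_right _ _

theorem exists_bump [T2Space X] [LocallyCompactSpace X] {x : X} {V : Set X} (hV : IsOpen V)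
    (hx : x ∈ V) :
    ∃ b : C₀(X, ℝ), b x = 1 ∧ (∀ z ∉ V, b z = 0) ∧ ∀ z, 0 ≤ b z ∧ b z ≤ 1 := by
  obtain ⟨b, h1, h0, hc, hb⟩ := exists_continuous_one_zero_of_isCompact
    (isCompact_singleton (x := x)) hV.isClosed_compl (by simpa using hx)
  exact ⟨⟨b, hc.is_zero_at_infty⟩, h1 rfl, fun z hz => h0 hz, hb⟩

section NormAdditive

variable [T2Space Y] [LocallyCompactSpace Y] {T : C₀(X, ℝ) → C₀(Y, ℝ)}

theorem map_add_apply_le_norm (hbij : Set.BijOn T (posCone X) (posCone Y))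
    (hnorm : ∀ f ∈ posCone X, ∀ g ∈ posCone X, ‖T (f + g)‖ = ‖T f + T g‖)
    {g h : C₀(X, ℝ)} (hg : g ∈ posCone X) (hh : h ∈ posCone X) {M : ℝ}
    (hM : ∀ z, T h z ≤ M) {z : Y} (hz : T h z = 0) : T (g + h) z ≤ ‖T g‖ := by
  obtain ⟨b, hb1, -, hb⟩ := exists_bump isOpen_univ (Set.mem_univ z)
  have hpos : M • b - b * T h ∈ posCone Y := fun t => by
    have := mul_nonneg (hb t).1 (sub_nonneg.2 (hM t))
    simp
    linarith
  obtain ⟨k, hk, hkT⟩ := hbij.surjOn hpos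
  have hhk : ‖T (h + k)‖ ≤ M := by
    rw [hnorm h hh k hk]
    refine norm_le (add_mem (hbij.mapsTo hh) (hbij.mapsTo hk)) z fun t => ?_
    have := mul_nonneg (sub_nonneg.2 (hb t).2) (sub_nonneg.2 (hM t))
    simp [hkT]
    linarith
  have hkz : T k z = M := by simp [hkT, hb1, hz]
  have h1 := apply_le_norm (T k + T (g + h)) z
  rw [← hnorm k hk _ (add_mem hg hh), show k + (g + h) = g + (h + k) by abel,
    hnorm g hg _ (add_mem hh hk), ZeroAtInftyContinuousMap.add_apply, hkz] at h1
  linarith [norm_add_le (T g) (T (h + k))]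

theorem map_add_apply (hbij : Set.BijOn T (posCone X) (posCone Y))
    (hnorm : ∀ f ∈ posCone X, ∀ g ∈ posCone X, ‖T (f + g)‖ = ‖T f + T g‖)
    {f g : C₀(X, ℝ)} (hf : f ∈ posCone X) (hg : g ∈ posCone X) (y : Y) :
    T (f + g) y = T f y + T g y := by
  have hTf := hbij.mapsTo hf
  have hTg := hbij.mapsTo hg
  have hTfg := hbij.mapsTo (add_mem hf hg)
  have key : ∀ ε > 0, |T (f + g) y - (T f y + T g y)| ≤ 3 * ε := by
    intro ε hε
    set V : Set Y := {z | |T f z - T f y| < ε ∧ |T g z - T g y| < ε ∧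
      |T (f + g) z - T (f + g) y| < ε}
    have hlt : ∀ u : C₀(Y, ℝ), IsOpen {z | |u z - u y| < ε} := fun u =>
      isOpen_lt (((map_continuous u).sub continuous_const).abs) continuous_const
    have hV : IsOpen V := (hlt _).inter ((hlt _).inter (hlt _))
    have hyV : y ∈ V := by simp [V, hε]
    obtain ⟨b, hb1, hb0, hb⟩ := exists_bump hV hyV
    set M : ℝ := ‖T f‖ + ‖T g‖ + ‖T (f + g)‖ + ε with hMdef
    have nf := norm_nonneg (T f)
    have ng := norm_nonneg (T g)
    have nfg := norm_nonneg (T (f + g))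
    have hM0 : 0 ≤ M := by positivity
    have hpos : M • b ∈ posCone Y := fun t => mul_nonneg hM0 (hb t).1
    obtain ⟨h, hh, hhT⟩ := hbij.surjOn hpos
    have hTh := hbij.mapsTo hh
    have hhM : ∀ z, T h z ≤ M := fun z => by
      rw [hhT]
      exact mul_le_of_le_one_right hM0 (hb z).2
    have hhy : T h y = M := by simp [hhT, hb1]
    have hhV : ∀ z ∉ V, T h z = 0 := fun z hz => by simp [hhT, hb0 z hz]
    have hTgh := hbij.mapsTo (add_mem hg hh)
    have hout : ∀ z ∉ V, T (g + h) z ≤ ‖T g‖ := fun z hz =>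
      map_add_apply_le_norm hbij hnorm hg hh hhM (hhV z hz)
    have gh_upper : ‖T (g + h)‖ ≤ M + T g y + ε := by
      rw [hnorm g hg h hh]
      refine norm_le (add_mem hTg hTh) y fun z => ?_
      rw [ZeroAtInftyContinuousMap.add_apply]
      by_cases hz : z ∈ V
      · linarith [(abs_lt.1 hz.2.1).2, hhM z]
      · linarith [hhV z hz, apply_le_norm (T g) z, hTg y]
    have gh_lower : M + T g y ≤ ‖T (g + h)‖ := by
      have := apply_le_norm (T g + T h) y
      rw [hnorm g hg h hh]
      rw [ZeroAtInftyContinuousMap.add_apply] at this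
      linarith
    have assoc : ‖T (f + g) + T h‖ = ‖T f + T (g + h)‖ := by
      rw [← hnorm _ (add_mem hf hg) h hh, ← hnorm f hf _ (add_mem hg hh), add_assoc]
    have upper : ‖T f + T (g + h)‖ ≤ M + T f y + T g y + 2 * ε := by
      refine norm_le (add_mem hTf hTgh) y fun z => ?_
      rw [ZeroAtInftyContinuousMap.add_apply]
      by_cases hz : z ∈ V
      · linarith [(abs_lt.1 hz.1).2, apply_le_norm (T (g + h)) z]
      · linarith [hout z hz, apply_le_norm (T f) z, hTf y, hTg y]
    have upper' : ‖T (f + g) + T h‖ ≤ M + T (f + g) y + ε := by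
      refine norm_le (add_mem hTfg hTh) y fun z => ?_
      rw [ZeroAtInftyContinuousMap.add_apply]
      by_cases hz : z ∈ V
      · linarith [(abs_lt.1 hz.2.2).2, hhM z]
      · linarith [hhV z hz, apply_le_norm (T (f + g)) z, hTfg y]
    have lower : M + T (f + g) y ≤ ‖T (f + g) + T h‖ := by
      have := apply_le_norm (T (f + g) + T h) y
      rw [ZeroAtInftyContinuousMap.add_apply] at this
      linarith
    have lower' : M + T g y ≤ ‖T f + T (g + h)‖ - T f y + ε := by
      refine gh_lower.trans (norm_le hTgh y fun z => ?_)
      have hz' := apply_le_norm (T f + T (g + h)) z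
      rw [ZeroAtInftyContinuousMap.add_apply] at hz'
      by_cases hz : z ∈ V
      · linarith [(abs_lt.1 hz.1).1]
      · linarith [hout z hz, apply_le_norm (T f) y, hTfg y]
    rw [abs_le]
    constructor <;> linarith
  by_contra hne
  have hpos := abs_pos.2 (sub_ne_zero.2 hne)
  linarith [key _ (show 0 < |T (f + g) y - (T f y + T g y)| / 4 by positivity)]

theorem map_nsmul_apply (hbij : Set.BijOn T (posCone X) (posCone Y))
    (hnorm : ∀ f ∈ posCone X, ∀ g ∈ posCone X, ‖T (f + g)‖ = ‖T f + T g‖)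
    {f : C₀(X, ℝ)} (hf : f ∈ posCone X) (y : Y) (n : ℕ) : T (n • f) y = n * T f y := by
  induction n with
  | zero =>
    have h0 : (0 : C₀(X, ℝ)) ∈ posCone X := fun _ => le_rfl
    have := map_add_apply hbij hnorm h0 h0 y
    rw [add_zero] at this
    simp only [zero_smul, Nat.cast_zero, zero_mul]
    linarith
  | succ n ih =>
    rw [succ_nsmul, map_add_apply hbij hnorm (nsmul_mem hf n) hf, ih]
    push_cast
    ring

theorem map_apply_le_of_eventually_le (hbij : Set.BijOn T (posCone X) (posCone Y))
    (hnorm : ∀ f ∈ posCone X, ∀ g ∈ posCone X, ‖T (f + g)‖ = ‖T f + T g‖)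
    {y : Y} {x₀ : X} (hsupp : ∀ g ∈ posCone X, 0 < T g y → x₀ ∈ tsupport g)
    {p q : C₀(X, ℝ)} (hp : p ∈ posCone X) (hq : q ∈ posCone X)
    (hpq : ∀ᶠ x in nhds x₀, p x ≤ q x) : T p y ≤ T q y := by
  have hpart := positivePart_mem (p - q)
  have hzero : T (positivePart (p - q)) y = 0 := by
    by_contra hne
    refine notMem_tsupport_iff_eventuallyEq.2 ?_
      (hsupp _ hpart (lt_of_le_of_ne (hbij.mapsTo hpart y) (Ne.symm hne)))
    filter_upwards [hpq] with x hx
    simpa [positivePart_apply] using hx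
  have hsum : p + positivePart (q - p) = q + positivePart (p - q) := by
    ext x
    simp only [ZeroAtInftyContinuousMap.add_apply, positivePart_apply,
      ZeroAtInftyContinuousMap.sub_apply]
    rcases le_total (p x) (q x) with hx | hx
    · rw [max_eq_left (by linarith), max_eq_right (by linarith)]
      ring
    · rw [max_eq_right (by linarith), max_eq_left (by linarith)]
      ring
  have hT := congrArg (fun u => T u y) hsum
  simp only [map_add_apply hbij hnorm hp (positivePart_mem _),
    map_add_apply hbij hnorm hq (positivePart_mem _)] at hT
  linarith [hbij.mapsTo (positivePart_mem (q - p)) y]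

end NormAdditive

end posCone

/-- **Lemma 3.4 (representation formula).** Let `T` be a norm additive bijection between
positive cones, `y ∈ Y`, and `x₀` the unique point with `⋂_{f ∈ F_y} supp(f) = {x₀}`.
Then for every `f ∈ C₀(X)⁺` and every `e ∈ C₀(X)⁺` equal to `1` on an open
neighborhood of `x₀`, one has `Tf(y) = Te(y) · f(x₀)`. -/
theorem stmt15 {X Y : Type*} [TopologicalSpace X] [T2Space X] [LocallyCompactSpace X]
    [TopologicalSpace Y] [T2Space Y] [LocallyCompactSpace Y]
    (T : C₀(X, ℝ) → C₀(Y, ℝ))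
    (hbij : Set.BijOn T (posCone X) (posCone Y))
    (hnorm : ∀ f ∈ posCone X, ∀ g ∈ posCone X, ‖T (f + g)‖ = ‖T f + T g‖)
    (y : Y) (x₀ : X)
    (hx₀ : (⋂ f ∈ {g : C₀(X, ℝ) | g ∈ posCone X ∧ 0 < T g y},
      tsupport (⇑f : X → ℝ)) = {x₀}) :
    ∀ f ∈ posCone X, ∀ e ∈ posCone X, ∀ U : Set X, IsOpen U → x₀ ∈ U →
      (∀ x ∈ U, e x = 1) → T f y = T e y * f x₀ := by
  intro f hf e he U hU hxU heU
  have hsupp : ∀ g ∈ posCone X, 0 < T g y → x₀ ∈ tsupport g := fun g hg hgy =>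
    Set.mem_iInter₂.1 (hx₀.symm ▸ Set.mem_singleton x₀) g ⟨hg, hgy⟩
  have hex : e x₀ = 1 := heU x₀ hxU
  have hey : 0 ≤ T e y := hbij.mapsTo he y
  have hfy : 0 ≤ T f y := hbij.mapsTo hf y
  have hfx : 0 ≤ f x₀ := hf x₀
  have compare : ∀ {p q : C₀(X, ℝ)}, p ∈ posCone X → q ∈ posCone X → ∀ m n : ℕ,
      m * p x₀ < n * q x₀ → m * T p y ≤ n * T q y := by
    intro p q hp hq m n h
    rw [← posCone.map_nsmul_apply hbij hnorm hp, ← posCone.map_nsmul_apply hbij hnorm hq]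
    refine posCone.map_apply_le_of_eventually_le hbij hnorm hsupp (posCone.nsmul_mem hp m)
      (posCone.nsmul_mem hq n) ?_
    have hlt : (m • p) x₀ < (n • q) x₀ := by simpa using h
    filter_upwards [(map_continuous (m • p)).continuousAt.eventually_lt
      (map_continuous (n • q)).continuousAt hlt] with x hx using hx.le
  have bound : ∀ n : ℕ, n * |T f y - T e y * f x₀| ≤ T e y := by
    intro n
    have hc : 0 ≤ n * f x₀ := by positivity
    have upper : n * T f y ≤ (n * f x₀ + 1) * T e y := by
      have h := compare hf he n (⌊n * f x₀⌋₊ + 1) (by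
        rw [hex, mul_one]
        exact_mod_cast Nat.lt_floor_add_one (n * f x₀))
      push_cast at h
      exact h.trans (mul_le_mul_of_nonneg_right (by linarith [Nat.floor_le hc]) hey)
    have lower : (n * f x₀ - 1) * T e y ≤ n * T f y := by
      rcases le_or_gt (n * f x₀) 1 with h1 | h1
      · exact (mul_nonpos_of_nonpos_of_nonneg (by linarith) hey).trans (by positivity)
      · obtain ⟨k, hk⟩ : ∃ k, ⌈n * f x₀⌉₊ = k + 1 :=
          Nat.exists_eq_succ_of_ne_zero (Nat.ceil_pos.2 (by linarith)).ne'
        have hlt := Nat.ceil_lt_add_one hc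
        have hle := Nat.le_ceil (n * f x₀)
        rw [hk] at hlt hle
        push_cast at hlt hle
        exact (mul_le_mul_of_nonneg_right (by linarith) hey).trans
          (compare he hf k n (by rw [hex]; linarith))
    rw [← Nat.abs_cast n, ← abs_mul, abs_le]
    constructor <;> linarith
  by_contra hne
  obtain ⟨n, hn⟩ := exists_nat_gt (T e y / |T f y - T e y * f x₀|)
  rw [div_lt_iff₀ (abs_pos.2 (sub_ne_zero.2 hne))] at hn
  exact absurd (bound n) (not_le.2 hn)
end

section
/- Let X and Y be locally compact Hausdorff spaces, let T : C₀(X)⁺ → C₀(Y)⁺ be a bijection satisfying ‖T(f+g)‖ = ‖Tf + Tg‖ for all f, g ∈ C₀(X)⁺, let τ : Y → X be the associated homeomorphism (with ⋂_{f ∈ F_y} supp(f) = {τ(y)}, F_y = {f ∈ C₀(X)⁺ : Tf(y) > 0}), and let h : Y → ℝ be defined by h(y) = Te(y) for any e ∈ C₀(X)⁺ equal to 1 on a neighborhood of τ(y). Then h is continuous, h(y) > 0 for every y ∈ Y, h is bounded above, and h is bounded away from zero (there exists c > 0 with h(y) ≥ c for all y ∈ Y). -/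
open scoped ZeroAtInfty

section PosCone

open Filter Topology Set

section Basic

variable {X : Type*} [TopologicalSpace X]

theorem zero_mem_posCone : (0 : C₀(X, ℝ)) ∈ posCone X := fun _ => le_rfl

theorem add_mem_posCone {f g : C₀(X, ℝ)} (hf : f ∈ posCone X) (hg : g ∈ posCone X) :
    f + g ∈ posCone X :=
  fun x => add_nonneg (hf x) (hg x)

theorem smul_mem_posCone {r : ℝ} (hr : 0 ≤ r) {f : C₀(X, ℝ)} (hf : f ∈ posCone X) :
    r • f ∈ posCone X :=
  fun x => mul_nonneg hr (hf x)

theorem nsmul_mem_posCone (n : ℕ) {f : C₀(X, ℝ)} (hf : f ∈ posCone X) :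
    n • f ∈ posCone X :=
  fun x => nsmul_nonneg (hf x) n

theorem ZeroAtInftyContinuousMap.abs_apply_le_norm (f : C₀(X, ℝ)) (x : X) : |f x| ≤ ‖f‖ :=
  f.toBCF.norm_coe_le_norm x

theorem ZeroAtInftyContinuousMap.apply_le_norm (f : C₀(X, ℝ)) (x : X) : f x ≤ ‖f‖ :=
  (le_abs_self _).trans (f.abs_apply_le_norm x)

theorem norm_le_of_mem_posCone {f : C₀(X, ℝ)} (hf : f ∈ posCone X) {C : ℝ} (hC : 0 ≤ C)
    (hle : ∀ x, f x ≤ C) : ‖f‖ ≤ C :=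
  (BoundedContinuousFunction.norm_le (f := f.toBCF) hC).2 fun x => by
    simpa [abs_of_nonneg (hf x)] using hle x

theorem norm_le_norm_of_mem_posCone {f g : C₀(X, ℝ)} (hf : f ∈ posCone X)
    (hle : ∀ x, f x ≤ g x) : ‖f‖ ≤ ‖g‖ :=
  norm_le_of_mem_posCone hf (norm_nonneg _) fun x => (hle x).trans (g.apply_le_norm x)

theorem exists_lt_apply_of_lt_norm {f : C₀(X, ℝ)} (hf : f ∈ posCone X) {C : ℝ} (hC : 0 ≤ C)
    (h : C < ‖f‖) : ∃ x, C < f x := by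
  by_contra! H
  exact h.not_ge (norm_le_of_mem_posCone hf hC H)

/-- A summable family in the positive cone is dominated termwise by its sum. -/
theorem apply_le_of_hasSum {F : ℕ → C₀(X, ℝ)} {S : C₀(X, ℝ)} (hF : ∀ n, F n ∈ posCone X)
    (hS : HasSum F S) (n : ℕ) (x : X) : F n x ≤ S x := by
  let ev : C₀(X, ℝ) →ₗ[ℝ] ℝ :=
    { toFun := fun f => f x, map_add' := fun _ _ => rfl, map_smul' := fun _ _ => rfl }
  have hsum : HasSum (fun n => F n x) (S x) :=
    (ev.mkContinuous 1 fun f => by simpa [ev] using f.abs_apply_le_norm x).hasSum hS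
  exact le_hasSum hsum n fun m _ => hF m x

theorem exists_bump [T2Space X] [LocallyCompactSpace X] {W : Set X} (hW : IsOpen W) {x : X}
    (hx : x ∈ W) : ∃ e ∈ posCone X, (∀ z, e z ≤ 1) ∧ tsupport e ⊆ W ∧
      ∃ V, IsOpen V ∧ x ∈ V ∧ ∀ z ∈ V, e z = 1 := by
  obtain ⟨K, hK, hxK, hKW⟩ := exists_compact_between isCompact_singleton hW
    (singleton_subset_iff.2 hx)
  obtain ⟨L, hL, hKL, hLW⟩ := exists_compact_between hK hW hKW
  obtain ⟨f, hf1, hf0, hfc, hf⟩ := exists_continuous_one_zero_of_isCompact hK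
    (isOpen_interior (s := L)).isClosed_compl (disjoint_compl_right_iff_subset.2 hKL)
  refine ⟨⟨f, hfc.is_zero_at_infty⟩, fun z => (hf z).1, fun z => (hf z).2, ?_,
    interior K, isOpen_interior, hxK rfl, fun z hz => hf1 (interior_subset hz)⟩
  refine (closure_minimal (fun z hz => ?_) hL.isClosed).trans hLW
  by_contra hzL
  exact hz (hf0 fun h => hzL (interior_subset h))

end Basic

variable {X Y : Type*} [TopologicalSpace X] [TopologicalSpace Y]

/-- A function on the cone with `‖T(f + g)‖ = ‖Tf + Tg‖` that is onto the cone is additive. -/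
theorem additive_of_norm_additive [T2Space Y] [LocallyCompactSpace Y]
    {T : C₀(X, ℝ) → C₀(Y, ℝ)}
    (hmaps : MapsTo T (posCone X) (posCone Y)) (hsurj : SurjOn T (posCone X) (posCone Y))
    (hnorm : ∀ f ∈ posCone X, ∀ g ∈ posCone X, ‖T (f + g)‖ = ‖T f + T g‖)
    {f g : C₀(X, ℝ)} (hf : f ∈ posCone X) (hg : g ∈ posCone X) :
    T (f + g) = T f + T g := by
  ext y
  set u := T f with hu
  set v := T g with hv
  set p := T (f + g) with hp
  have hu0 : u ∈ posCone Y := hmaps hf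
  have hv0 : v ∈ posCone Y := hmaps hg
  have hp0 : p ∈ posCone Y := hmaps (add_mem_posCone hf hg)
  have key : ∀ ε : ℝ, 0 < ε → ε < 1 → |p y - (u y + v y)| ≤ 3 * ε := by
    intro ε hε hε1
    let W : Set Y := {z | |u z - u y| < ε} ∩ {z | |v z - v y| < ε} ∩ {z | |p z - p y| < ε}
    have hWo : IsOpen W :=
      ((isOpen_lt (by fun_prop) (by fun_prop)).inter
        (isOpen_lt (by fun_prop) (by fun_prop))).inter (isOpen_lt (by fun_prop) (by fun_prop))
    have hyW : y ∈ W := by simp [W, hε]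
    set N : ℝ := ‖u‖ + ‖v‖ + ‖p‖ + 2 with hN
    have hun := norm_nonneg u
    have hvn := norm_nonneg v
    have hpn := norm_nonneg p
    have hNpos : 0 ≤ N := by positivity
    obtain ⟨b, hb0, hb1, hbW, V, -, hyV, hbV⟩ := exists_bump hWo hyW
    have hby : b y = 1 := hbV y hyV
    have hbz : ∀ z ∉ W, b z = 0 := fun z hz =>
      image_eq_zero_of_notMem_tsupport fun h => hz (hbW h)
    set w := N • b with hw
    have hwz : ∀ z, w z = N * b z := fun z => rfl
    have hw0 : w ∈ posCone Y := smul_mem_posCone hNpos hb0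
    have hwN : ∀ z, w z ≤ N := fun z => by
      rw [hwz]; exact mul_le_of_le_one_right hNpos (hb1 z)
    have hwW : ∀ z ∉ W, w z = 0 := fun z hz => by rw [hwz, hbz z hz, mul_zero]
    have hwy : w y = N := by rw [hwz, hby, mul_one]
    obtain ⟨k, hk0, hk⟩ := hsurj hw0
    set q := T (g + k) with hq
    have hq0 : q ∈ posCone Y := hmaps (add_mem_posCone hg hk0)
    have hqn : ‖q‖ = ‖v + w‖ := by rw [hq, hnorm g hg k hk0, hk]
    have hpq : ‖p + w‖ = ‖u + q‖ := by
      rw [← hk, hp, ← hnorm _ (add_mem_posCone hf hg) k hk0, add_assoc,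
        hnorm f hf _ (add_mem_posCone hg hk0)]
    have hqW : ∀ z ∉ W, q z ≤ ‖v‖ + ε := by
      intro z hz
      have hWo' : IsOpen {t | w t < ε} := isOpen_lt (by fun_prop) (by fun_prop)
      have hzW' : z ∈ {t | w t < ε} := by simpa [hwW z hz] using hε
      obtain ⟨c, hc0, hc1, hcW, V', -, hzV', hcV'⟩ := exists_bump hWo' hzW'
      have hNc : N • c ∈ posCone Y := smul_mem_posCone hNpos hc0
      obtain ⟨l, hl0, hl⟩ := hsurj hNc
      have h1 : ‖q + N • c‖ = ‖v + T (k + l)‖ := by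
        rw [← hl, hq, ← hnorm _ (add_mem_posCone hg hk0) l hl0, add_assoc,
          hnorm g hg _ (add_mem_posCone hk0 hl0)]
      have h2 : ‖T (k + l)‖ ≤ N + ε := by
        rw [hnorm k hk0 l hl0, hk, hl]
        refine norm_le_of_mem_posCone (add_mem_posCone hw0 hNc) (by positivity) fun t => ?_
        change w t + N * c t ≤ N + ε
        by_cases ht : w t < ε
        · have := mul_le_of_le_one_right hNpos (hc1 t)
          linarith
        · have : c t = 0 := image_eq_zero_of_notMem_tsupport fun h => ht (hcW h)
          rw [this, mul_zero, add_zero]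
          linarith [hwN t]
      have h3 := (q + N • c).apply_le_norm z
      have h4 : (q + N • c) z = q z + N := by
        change q z + N * c z = _
        rw [hcV' z hzV', mul_one]
      have h5 := norm_add_le v (T (k + l))
      linarith
    have hW : ∀ z ∈ W, |u z - u y| < ε ∧ |v z - v y| < ε ∧ |p z - p y| < ε :=
      fun z hz => ⟨hz.1.1, hz.1.2, hz.2⟩
    have hupper : p y ≤ u y + v y + 2 * ε := by
      have h1 : p y + N ≤ ‖p + w‖ := by
        have := (p + w).apply_le_norm y
        rwa [ZeroAtInftyContinuousMap.add_apply, hwy] at this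
      have h2 : ‖v + w‖ ≤ v y + ε + N := by
        have := hv0 y
        refine norm_le_of_mem_posCone (add_mem_posCone hv0 hw0) (by positivity) fun z => ?_
        rw [ZeroAtInftyContinuousMap.add_apply]
        by_cases hz : z ∈ W
        · linarith [(abs_lt.1 (hW z hz).2.1).2, hwN z]
        · linarith [hwW z hz, v.apply_le_norm z]
      have h3 : ‖u + q‖ ≤ u y + v y + 2 * ε + N := by
        have := hu0 y
        have := hv0 y
        refine norm_le_of_mem_posCone (add_mem_posCone hu0 hq0) (by positivity) fun z => ?_
        rw [ZeroAtInftyContinuousMap.add_apply]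
        by_cases hz : z ∈ W
        · linarith [(abs_lt.1 (hW z hz).1).2, q.apply_le_norm z]
        · linarith [hqW z hz, u.apply_le_norm z]
      linarith
    have hlower : u y + v y ≤ p y + 3 * ε := by
      have h1 : v y + N ≤ ‖v + w‖ := by
        have := (v + w).apply_le_norm y
        rwa [ZeroAtInftyContinuousMap.add_apply, hwy] at this
      obtain ⟨z, hz⟩ : ∃ z, v y + N - ε < q z :=
        exists_lt_apply_of_lt_norm hq0 (by linarith [hv0 y]) (by linarith)
      have hzW : z ∈ W := by
        by_contra hzW
        linarith [hqW z hzW, hv0 y]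
      have h2 : u z + q z ≤ ‖u + q‖ := (u + q).apply_le_norm z
      have h3 : ‖p + w‖ ≤ p y + ε + N := by
        have := hp0 y
        refine norm_le_of_mem_posCone (add_mem_posCone hp0 hw0) (by positivity) fun t => ?_
        rw [ZeroAtInftyContinuousMap.add_apply]
        by_cases ht : t ∈ W
        · linarith [(abs_lt.1 (hW t ht).2.2).2, hwN t]
        · linarith [hwW t ht, p.apply_le_norm t]
      linarith [(abs_lt.1 (hW z hzW).1).1]
    rw [abs_le]
    constructor <;> linarith
  rw [ZeroAtInftyContinuousMap.add_apply]
  by_contra hne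
  have hpos : 0 < |p y - (u y + v y)| := abs_pos.2 (sub_ne_zero.2 hne)
  have h1 := key (min (1 / 2) (|p y - (u y + v y)| / 4)) (by positivity)
    ((min_le_left _ _).trans_lt (by norm_num))
  have h2 := min_le_right (1 / 2) (|p y - (u y + v y)| / 4)
  linarith

theorem apply_le_apply_of_additive {S : C₀(X, ℝ) → C₀(Y, ℝ)}
    (hmaps : MapsTo S (posCone X) (posCone Y))
    (hadd : ∀ f ∈ posCone X, ∀ g ∈ posCone X, S (f + g) = S f + S g)
    {f g : C₀(X, ℝ)} (hf : f ∈ posCone X)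
    (hle : ∀ x, f x ≤ g x) (y : Y) : S f y ≤ S g y := by
  have hd : g - f ∈ posCone X := fun x => sub_nonneg.2 (hle x)
  rw [← add_sub_cancel f g, hadd f hf _ hd]
  exact le_add_of_nonneg_right (hmaps hd y)

theorem map_nsmul_of_additive {S : C₀(X, ℝ) → C₀(Y, ℝ)}
    (hadd : ∀ f ∈ posCone X, ∀ g ∈ posCone X, S (f + g) = S f + S g)
    {f : C₀(X, ℝ)} (hf : f ∈ posCone X) (n : ℕ) :
    S (n • f) = n • S f := by
  induction n with
  | zero =>
    have := hadd 0 zero_mem_posCone 0 zero_mem_posCone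
    rw [add_zero] at this
    simpa using this
  | succ n ih => rw [succ_nsmul, hadd _ (nsmul_mem_posCone n hf) f hf, ih, succ_nsmul]

/-- An additive map between positive cones is bounded. -/
theorem exists_norm_le_of_additive {S : C₀(X, ℝ) → C₀(Y, ℝ)}
    (hmaps : MapsTo S (posCone X) (posCone Y))
    (hadd : ∀ f ∈ posCone X, ∀ g ∈ posCone X, S (f + g) = S f + S g) :
    ∃ n : ℕ, ∀ f ∈ posCone X, ‖f‖ ≤ 1 → ‖S f‖ ≤ n := by
  by_contra! H
  choose f hf hf1 hfn using fun n : ℕ => H (4 ^ n)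
  have hF : ∀ n, ((1 / 2 : ℝ) ^ n • f n) ∈ posCone X := fun n =>
    smul_mem_posCone (by positivity) (hf n)
  have hsum : Summable fun n => (1 / 2 : ℝ) ^ n • f n := by
    refine Summable.of_norm_bounded summable_geometric_two fun n => ?_
    rw [norm_smul, Real.norm_of_nonneg (by positivity)]
    exact mul_le_of_le_one_right (by positivity) (hf1 n)
  obtain ⟨F, hFsum⟩ := hsum
  have hlt : ∀ n : ℕ, (2 : ℝ) ^ n < ‖S F‖ := by
    intro n
    have h1 : ‖S ((1 / 2 : ℝ) ^ n • f n)‖ ≤ ‖S F‖ :=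
      norm_le_norm_of_mem_posCone (hmaps (hF n)) fun y =>
        apply_le_apply_of_additive hmaps hadd (hF n) (apply_le_of_hasSum hF hFsum n) y
    have h2 : (2 ^ n : ℕ) • ((1 / 2 : ℝ) ^ n • f n) = f n := by
      rw [← Nat.cast_smul_eq_nsmul ℝ, smul_smul]
      push_cast
      rw [← mul_pow]
      norm_num
    have h3 : ‖S (f n)‖ = 2 ^ n * ‖S ((1 / 2 : ℝ) ^ n • f n)‖ := by
      conv_lhs => rw [← h2]
      rw [map_nsmul_of_additive hadd (hF n), ← Nat.cast_smul_eq_nsmul ℝ, norm_smul]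
      simp
    have h4 := hfn n
    rw [h3] at h4
    push_cast at h4
    rw [show (4 : ℝ) = 2 * 2 by norm_num, mul_pow] at h4
    exact (lt_of_mul_lt_mul_left h4 (by positivity)).trans_le h1
  obtain ⟨n, hn⟩ := pow_unbounded_of_one_lt ‖S F‖ one_lt_two
  exact (hlt n).not_gt hn

end PosCone

/-- **Lemma 3.5.** Let `T` be a norm additive bijection between positive cones, `τ` the
associated point map (`⋂_{f ∈ F_y} supp(f) = {τ(y)}`), and `h(y) = Te(y)` for any
`e ∈ C₀(X)⁺` equal to `1` on an open neighborhood of `τ(y)`. Then `h` is continuous,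
strictly positive, bounded above, and bounded away from zero. -/
theorem stmt16 {X Y : Type*} [TopologicalSpace X] [T2Space X] [LocallyCompactSpace X]
    [TopologicalSpace Y] [T2Space Y] [LocallyCompactSpace Y]
    (T : C₀(X, ℝ) → C₀(Y, ℝ))
    (hbij : Set.BijOn T (posCone X) (posCone Y))
    (hnorm : ∀ f ∈ posCone X, ∀ g ∈ posCone X, ‖T (f + g)‖ = ‖T f + T g‖)
    (τ : Y → X)
    (hτ : ∀ y : Y,
      (⋂ f ∈ {g : C₀(X, ℝ) | g ∈ posCone X ∧ 0 < T g y}, tsupport (⇑f : X → ℝ))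
        = {τ y})
    (h : Y → ℝ)
    (hh : ∀ y : Y, ∀ e ∈ posCone X, ∀ U : Set X, IsOpen U → τ y ∈ U →
      (∀ x ∈ U, e x = 1) → h y = T e y) :
    Continuous h ∧ (∀ y : Y, 0 < h y) ∧ (∃ M : ℝ, ∀ y : Y, h y ≤ M) ∧
      (∃ c : ℝ, 0 < c ∧ ∀ y : Y, c ≤ h y) := by
  have hmaps := hbij.mapsTo
  have hadd : ∀ f ∈ posCone X, ∀ g ∈ posCone X, T (f + g) = T f + T g := fun f hf g hg =>
    additive_of_norm_additive hmaps hbij.surjOn hnorm hf hg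
  have hsupp : ∀ f ∈ posCone X, ∀ y, 0 < T f y → τ y ∈ tsupport f := fun f hf y hy => by
    have : τ y ∈ ({τ y} : Set X) := rfl
    rw [← hτ y] at this
    exact Set.mem_iInter₂.1 this f ⟨hf, hy⟩
  have hbump : ∀ y, ∃ e ∈ posCone X, (∀ z, e z ≤ 1) ∧
      ∃ V, IsOpen V ∧ τ y ∈ V ∧ ∀ z ∈ V, e z = 1 := fun y => by
    obtain ⟨e, he0, he1, -, hV⟩ := exists_bump isOpen_univ (Set.mem_univ (τ y))
    exact ⟨e, he0, he1, hV⟩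
  obtain ⟨M, hM⟩ := exists_norm_le_of_additive hmaps hadd
  have habove : ∀ y, h y ≤ M := by
    intro y
    obtain ⟨e, he0, he1, V, hVo, hyV, heV⟩ := hbump y
    rw [hh y e he0 V hVo hyV heV]
    exact ((T e).apply_le_norm y).trans
      (hM e he0 (norm_le_of_mem_posCone he0 zero_le_one he1))
  let S : C₀(Y, ℝ) → C₀(X, ℝ) := Function.invFunOn T (posCone X)
  have hSmaps : Set.MapsTo S (posCone Y) (posCone X) := hbij.surjOn.mapsTo_invFunOn
  have hTS : ∀ u ∈ posCone Y, T (S u) = u := fun u hu => hbij.surjOn.rightInvOn_invFunOn hu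
  have hSadd : ∀ u ∈ posCone Y, ∀ v ∈ posCone Y, S (u + v) = S u + S v := by
    intro u hu v hv
    refine hbij.injOn (hSmaps (add_mem_posCone hu hv))
      (add_mem_posCone (hSmaps hu) (hSmaps hv)) ?_
    rw [hTS _ (add_mem_posCone hu hv), hadd _ (hSmaps hu) _ (hSmaps hv), hTS u hu, hTS v hv]
  obtain ⟨n, hn⟩ := exists_norm_le_of_additive hSmaps hSadd
  have hbelow : ∀ y, 1 ≤ n * h y := by
    intro y
    obtain ⟨u, hu0, hu1, -, V', -, hyV', huV'⟩ := exists_bump isOpen_univ (Set.mem_univ y)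
    set k := S u with hk
    have hk0 : k ∈ posCone X := hSmaps hu0
    have hTk : T k y = 1 := by rw [hk, hTS u hu0, huV' y hyV']
    have hkn : ‖k‖ ≤ n := hn u hu0 (norm_le_of_mem_posCone hu0 zero_le_one hu1)
    obtain ⟨e, he0, he1, V, hVo, hyV, heV⟩ := hbump y
    have hr0 : k - k * e ∈ posCone X := fun x =>
      sub_nonneg.2 (mul_le_of_le_one_right (hk0 x) (he1 x))
    have hr : T (k - k * e) y ≤ 0 := by
      by_contra! hpos
      have hsub : tsupport ⇑(k - k * e) ⊆ Vᶜ := by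
        refine closure_minimal (fun x hx hxV => hx ?_) hVo.isClosed_compl
        change k x - k x * e x = 0
        rw [heV x hxV, mul_one, sub_self]
      exact hsub (hsupp _ hr0 y hpos) hyV
    have hle : T k y ≤ T (n • e + (k - k * e)) y := by
      refine apply_le_apply_of_additive hmaps hadd hk0 (fun x => ?_) y
      have h1 : (n • e + (k - k * e)) x = n * e x + (k x - k x * e x) := by
        simp
      rw [h1]
      have h2 := mul_le_mul_of_nonneg_right ((k.apply_le_norm x).trans hkn) (he0 x)
      linarith
    rw [hadd _ (nsmul_mem_posCone n he0) _ hr0, map_nsmul_of_additive hadd he0, hTk,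
      ZeroAtInftyContinuousMap.add_apply] at hle
    have h3 : (n • T e) y = n * T e y := by simp
    rw [hh y e he0 V hVo hyV heV]
    linarith
  have hpos : ∀ y, 0 < h y := fun y =>
    pos_of_mul_pos_right (zero_lt_one.trans_le (hbelow y)) n.cast_nonneg
  refine ⟨?_, hpos, ⟨M, habove⟩, 1 / (n + 1), by positivity, fun y => ?_⟩
  · refine continuous_iff_continuousAt.2 fun y => ?_
    obtain ⟨e, he0, he1, V, hVo, hyV, heV⟩ := hbump y
    obtain ⟨d, hd0, -, hdV, U, hUo, hyU, hdU⟩ := exists_bump hVo hyV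
    have hdy : 0 < T d y := hh y d hd0 U hUo hyU hdU ▸ hpos y
    have hnear : ∀ᶠ z in nhds y, T e z = h z := by
      filter_upwards [(T d).continuous.continuousAt.eventually (lt_mem_nhds hdy)] with z hz
      exact (hh z e he0 V hVo (hdV (hsupp d hd0 z hz)) heV).symm
    exact ((T e).continuous.continuousAt).congr hnear
  · rw [div_le_iff₀ (by positivity)]
    linarith [hbelow y, hpos y]
end
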